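/- Let X be a geodesic metric space, e ∈ X, and let N ≤ N' be Morse gauges (pointwise order). The inclusion X^(N)_e ⊆ X^(N')_e induces a well-defined injective map ι : ∂X^(N)_e → ∂X^(N')_e between the sequential boundaries, and for any visual metric on ∂X^(N)_e and any visual metric on ∂X^(N')_e, the map ι is a quasi-symmetry onto its image. -/

import Mathlib

open Set Filter

section Defs

variable {X : Type*} [MetricSpace X]

/-- A geodesic segment of length `L`, parametrized by arc length on `[0, L]`. -/
def IsGeodesicSeg (γ : ℝ → X) (L : ℝ) : Prop :=
  0 ≤ L ∧ ∀ s ∈ Icc (0:ℝ) L, ∀ t ∈ Icc (0:ℝ) L, dist (γ s) (γ t) = |s - t|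

/-- A geodesic from `x` to `y`, parametrized by arc length on `[0, dist x y]`. -/
def IsGeodesicFromTo (γ : ℝ → X) (x y : X) : Prop :=
  IsGeodesicSeg γ (dist x y) ∧ γ 0 = x ∧ γ (dist x y) = y

/-- A geodesic ray, parametrized by arc length on `[0, ∞)`. -/
def IsGeodesicRay (ℓ : ℝ → X) : Prop :=
  ∀ s ∈ Ici (0:ℝ), ∀ t ∈ Ici (0:ℝ), dist (ℓ s) (ℓ t) = |s - t|

/-- A geodesic metric space: any two points are joined by a geodesic. -/
def GeodesicSpace (X : Type*) [MetricSpace X] : Prop :=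
  ∀ x y : X, ∃ γ : ℝ → X, IsGeodesicFromTo γ x y

/-- A `(K, C)`-quasi-geodesic defined on the interval `I ⊆ ℝ`. -/
def IsQuasiGeodesicOn (K C : ℝ) (I : Set ℝ) (σ : ℝ → X) : Prop :=
  ∀ s ∈ I, ∀ t ∈ I,
    |s - t| / K - C ≤ dist (σ s) (σ t) ∧ dist (σ s) (σ t) ≤ K * |s - t| + C

/-- A Morse gauge: a nonnegative real `N K C` for every `K ≥ 1`, `C ≥ 0`. -/
def IsMorseGauge (N : ℝ → ℝ → ℝ) : Prop :=
  ∀ K C : ℝ, 1 ≤ K → 0 ≤ C → 0 ≤ N K C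

/-- A subset `G ⊆ X` is `N`-Morse if for all `K ≥ 1`, `C ≥ 0`, every
`(K,C)`-quasi-geodesic with endpoints on `G` is contained in the closed
`N K C`-neighbourhood of `G`. -/
def IsMorseSet (N : ℝ → ℝ → ℝ) (G : Set X) : Prop :=
  ∀ K C : ℝ, 1 ≤ K → 0 ≤ C → ∀ a b : ℝ, a ≤ b → ∀ σ : ℝ → X,
    IsQuasiGeodesicOn K C (Icc a b) σ → σ a ∈ G → σ b ∈ G →
    ∀ s ∈ Icc a b, ∃ g ∈ G, dist (σ s) g ≤ N K C

/-- An `N`-Morse geodesic from `x` to `y`. -/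
def IsMorseGeodesicFromTo (N : ℝ → ℝ → ℝ) (γ : ℝ → X) (x y : X) : Prop :=
  IsGeodesicFromTo γ x y ∧ IsMorseSet N (γ '' Icc 0 (dist x y))

/-- An `N`-Morse geodesic ray. -/
def IsMorseRay (N : ℝ → ℝ → ℝ) (ℓ : ℝ → X) : Prop :=
  IsGeodesicRay ℓ ∧ IsMorseSet N (ℓ '' Ici 0)

/-- The stratum `X^(N)_e`: points joined to `e` by an `N`-Morse geodesic. -/
def morseStratum (N : ℝ → ℝ → ℝ) (e : X) : Set X :=
  {y | ∃ γ : ℝ → X, IsMorseGeodesicFromTo N γ e y}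

/-- The Gromov product `(x·y)_w`. -/
noncomputable def gprod (w x y : X) : ℝ := (dist w x + dist w y - dist x y) / 2

/-- A `B`-quasi-convex subset: geodesics with endpoints in `Y` stay in the
closed `B`-neighbourhood of `Y`. -/
def IsQuasiConvex (B : ℝ) (Y : Set X) : Prop :=
  ∀ x ∈ Y, ∀ y ∈ Y, ∀ γ : ℝ → X, IsGeodesicFromTo γ x y →
    ∀ s ∈ Icc (0:ℝ) (dist x y), ∃ g ∈ Y, dist (γ s) g ≤ B

/-- An `N`-stable subset: quasi-convex, and any two of its points are joined
by an `N`-Morse geodesic of `X`. -/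
def IsStableSubset (N : ℝ → ℝ → ℝ) (Y : Set X) : Prop :=
  (∃ B : ℝ, 0 ≤ B ∧ IsQuasiConvex B Y) ∧
    ∀ x ∈ Y, ∀ y ∈ Y, ∃ γ : ℝ → X, IsMorseGeodesicFromTo N γ x y

variable {Y : Type*} [MetricSpace Y]

/-- A `(K,C)`-quasi-isometric embedding. -/
def IsQIEmbedding (K C : ℝ) (q : X → Y) : Prop :=
  ∀ x x' : X,
    dist x x' / K - C ≤ dist (q x) (q x') ∧ dist (q x) (q x') ≤ K * dist x x' + C

/-- A `(K,C)`-quasi-isometry. -/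
def IsQuasiIsometry (K C : ℝ) (q : X → Y) : Prop :=
  IsQIEmbedding K C q ∧ ∀ y : Y, ∃ x : X, dist y (q x) ≤ C

end Defs

section Boundary

variable {X : Type*} [MetricSpace X]

/-- A sequence converges at infinity with respect to the basepoint `e`. -/
def ConvAtInf (e : X) (f : ℕ → X) : Prop :=
  Tendsto (fun p : ℕ × ℕ => gprod e (f p.1) (f p.2)) atTop atTop

/-- Two sequences converging at infinity are equivalent. -/
def EquivAtInf (e : X) (f g : ℕ → X) : Prop :=
  Tendsto (fun p : ℕ × ℕ => gprod e (f p.1) (g p.2)) atTop atTop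

/-- Sequences in `S` converging at infinity. -/
abbrev BSeq (S : Set X) (e : X) : Type _ :=
  {f : ℕ → X // (∀ n, f n ∈ S) ∧ ConvAtInf e f}

/-- The sequential boundary of `S ⊆ X` with basepoint `e`: sequences in `S`
converging at infinity, up to equivalence. -/
def SeqBoundary (S : Set X) (e : X) : Type _ :=
  Quot (fun f g : BSeq S e => EquivAtInf e f.1 g.1)

/-- The boundary point represented by a convergent sequence. -/
def SeqBoundary.mk {S : Set X} {e : X} (f : BSeq S e) : SeqBoundary S e :=
  Quot.mk _ f

/-- The liminf of Gromov products of two sequences, valued in `EReal`. -/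
noncomputable def seqGP (e : X) (f g : ℕ → X) : EReal :=
  Filter.liminf (fun p : ℕ × ℕ => ((gprod e (f p.1) (g p.2) : ℝ) : EReal)) atTop

/-- The Gromov product of two boundary points: the supremum over representing
sequences of the liminf of Gromov products. -/
noncomputable def bGP (S : Set X) (e : X) (ξ η : SeqBoundary S e) : EReal :=
  sSup {r : EReal | ∃ f g : BSeq S e,
    SeqBoundary.mk f = ξ ∧ SeqBoundary.mk g = η ∧ r = seqGP e f.1 g.1}

open Classical in
/-- `exp (−ε·r)` for an extended real `r`, with value `0` at `r = ⊤`. -/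
noncomputable def visGauge (ε : ℝ) (r : EReal) : ℝ :=
  if r = ⊤ then 0 else Real.exp (-ε * r.toReal)

/-- `d` is a visual metric on the sequential boundary of `S`:
a metric comparable to `exp(−ε·(Gromov product))` for some parameter `ε > 0`. -/
def IsVisualMetric (S : Set X) (e : X)
    (d : SeqBoundary S e → SeqBoundary S e → ℝ) : Prop :=
  (∀ ξ η, 0 ≤ d ξ η) ∧ (∀ ξ η, d ξ η = d η ξ) ∧
  (∀ ξ η ζ, d ξ ζ ≤ d ξ η + d η ζ) ∧ (∀ ξ η, d ξ η = 0 ↔ ξ = η) ∧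
  ∃ ε : ℝ, 0 < ε ∧ ∃ k₁ : ℝ, 0 < k₁ ∧ ∃ k₂ : ℝ, 0 < k₂ ∧
    ∀ ξ η, k₁ * visGauge ε (bGP S e ξ η) ≤ d ξ η ∧
      d ξ η ≤ k₂ * visGauge ε (bGP S e ξ η)

/-- `η` is (the restriction of) a self-homeomorphism of `[0,∞)`. -/
def IsHomeoIci (η : ℝ → ℝ) : Prop :=
  ContinuousOn η (Ici 0) ∧ StrictMonoOn η (Ici 0) ∧ η 0 = 0 ∧
    Tendsto η atTop atTop ∧ ∀ t ∈ Ici (0:ℝ), 0 ≤ η t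

/-- `F` is a quasi-symmetry onto its image, for the "distances" `dA`, `dB`. -/
def IsQuasiSymmetryOnto {A B : Type*} (dA : A → A → ℝ) (dB : B → B → ℝ)
    (F : A → B) : Prop :=
  Function.Injective F ∧ ∃ η : ℝ → ℝ, IsHomeoIci η ∧
    ∀ x y z : A, x ≠ y → x ≠ z → y ≠ z →
      dB (F x) (F y) / dB (F x) (F z) ≤ η (dA x y / dA x z)

end Boundary

/-- `X` (with basepoint `x`) is stably subsumed by `Y` (with basepoint `y`):
every stratum of `X` quasi-isometrically embeds in some stratum of `Y`. -/
def StablySubsumed (X Y : Type*) [MetricSpace X] [MetricSpace Y]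
    (x : X) (y : Y) : Prop :=
  ∀ N : ℝ → ℝ → ℝ, IsMorseGauge N →
    ∃ N' : ℝ → ℝ → ℝ, IsMorseGauge N' ∧
      ∃ K C : ℝ, 1 ≤ K ∧ 0 ≤ C ∧ ∃ f : X → Y,
        (∀ a ∈ morseStratum N x, f a ∈ morseStratum N' y) ∧
        ∀ a ∈ morseStratum N x, ∀ b ∈ morseStratum N x,
          dist a b / K - C ≤ dist (f a) (f b) ∧ dist (f a) (f b) ≤ K * dist a b + C

/-- Durham–Taylor stability of `f : Y → X`. -/
def DTStable {Y X : Type*} [MetricSpace Y] [MetricSpace X] (f : Y → X) : Prop :=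
  ∀ K C : ℝ, 1 ≤ K → 0 ≤ C → ∃ R : ℝ, 0 ≤ R ∧
    ∀ a₁ b₁ a₂ b₂ : ℝ, a₁ ≤ b₁ → a₂ ≤ b₂ → ∀ σ₁ σ₂ : ℝ → X,
      IsQuasiGeodesicOn K C (Icc a₁ b₁) σ₁ → IsQuasiGeodesicOn K C (Icc a₂ b₂) σ₂ →
      σ₁ a₁ = σ₂ a₂ → σ₁ b₁ = σ₂ b₂ →
      σ₁ a₁ ∈ Set.range f → σ₁ b₁ ∈ Set.range f →
      (∀ s ∈ Icc a₁ b₁, ∃ t ∈ Icc a₂ b₂, dist (σ₁ s) (σ₂ t) ≤ R) ∧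
      (∀ t ∈ Icc a₂ b₂, ∃ s ∈ Icc a₁ b₁, dist (σ₁ s) (σ₂ t) ≤ R)

section Helpers

variable {X : Type*} [MetricSpace X]

lemma gprod_comm' (w x y : X) : gprod w x y = gprod w y x := by
  unfold gprod; rw [dist_comm x y]; ring

lemma gprod_nonneg' (w x y : X) : 0 ≤ gprod w x y := by
  unfold gprod
  have := dist_triangle x w y
  rw [dist_comm x w] at this
  linarith

lemma gprod_le_left (w x y : X) : gprod w x y ≤ dist w x := by
  unfold gprod
  have := dist_triangle w x y
  linarith

lemma gprod_le_right (w x y : X) : gprod w x y ≤ dist w y := by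
  rw [gprod_comm']; exact gprod_le_left w y x

/-- The concatenation of a shortest path from `e` to a geodesic with a piece of this geodesic
is a `(3,0)`-quasi-geodesic. -/
lemma concat_quasi (e p x : X) (α β : ℝ → X) (hα : IsGeodesicFromTo α e p)
    (hβ : IsGeodesicFromTo β p x)
    (hmin : ∀ s ∈ Icc (0:ℝ) (dist p x), dist e p ≤ dist e (β s)) :
    IsQuasiGeodesicOn 3 0 (Icc 0 (dist e p + dist p x))
      (fun t => if t ≤ dist e p then α t else β (t - dist e p)) := by
  obtain ⟨⟨ha0, ha⟩, hα0, hα1⟩ := hα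
  obtain ⟨⟨hb0, hb⟩, hβ0, hβ1⟩ := hβ
  set a := dist e p with hadef
  set b := dist p x with hbdef
  have key : ∀ s ∈ Icc (0:ℝ) a, ∀ t ∈ Icc (0:ℝ) b,
      a - s + t ≤ 3 * dist (α s) (β t) ∧ dist (α s) (β t) ≤ a - s + t := by
    intro s hs t ht
    have h1 : dist e (α s) = s := by
      rw [← hα0, ha 0 ⟨le_rfl, ha0⟩ s hs]
      rw [zero_sub, abs_neg, abs_of_nonneg hs.1]
    have h2 : dist (α s) p = a - s := by
      conv_lhs => rw [← hα1]
      rw [ha s hs a ⟨ha0, le_rfl⟩, abs_sub_comm, abs_of_nonneg (by linarith [hs.2])]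
    have h3 : dist p (β t) = t := by
      conv_lhs => rw [← hβ0]
      rw [hb 0 ⟨le_rfl, hb0⟩ t ht]
      rw [zero_sub, abs_neg, abs_of_nonneg ht.1]
    have h4 := hmin t ht
    have h5 := dist_triangle e (α s) (β t)
    have h6 := dist_triangle p (α s) (β t)
    have h7 := dist_triangle (α s) p (β t)
    rw [dist_comm p (α s)] at h6
    constructor <;> linarith
  have main : ∀ s ∈ Icc (0:ℝ) (a+b), ∀ t ∈ Icc (0:ℝ) (a+b), s ≤ t →
      |s - t| / 3 - 0 ≤ dist (if s ≤ a then α s else β (s - a)) (if t ≤ a then α t else β (t - a))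
      ∧ dist (if s ≤ a then α s else β (s - a)) (if t ≤ a then α t else β (t - a))
        ≤ 3 * |s - t| + 0 := by
    intro s hs t ht hst
    have habs : |s - t| = t - s := by rw [abs_sub_comm, abs_of_nonneg (by linarith)]
    rw [habs]
    split_ifs with h1 h2 h2
    · rw [ha s ⟨hs.1, h1⟩ t ⟨ht.1, h2⟩, habs]; constructor <;> linarith
    · obtain ⟨k1, k2⟩ := key s ⟨hs.1, h1⟩ (t - a) ⟨by linarith, by linarith [ht.2]⟩
      constructor <;> linarith
    · exact absurd (hst.trans h2) h1
    · rw [hb (s - a) ⟨by linarith, by linarith [hs.2]⟩ (t - a) ⟨by linarith, by linarith [ht.2]⟩]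
      have : s - a - (t - a) = s - t := by ring
      rw [this, habs]; constructor <;> linarith
  intro s hs t ht
  rcases le_total s t with h | h
  · exact main s hs t ht h
  · have := main t ht s hs h
    rw [abs_sub_comm, dist_comm]
    exact this

/-- One side of the triangle. -/
lemma side_close (N : ℝ → ℝ → ℝ) (e p x : X) (α β γ : ℝ → X)
    (hα : IsGeodesicFromTo α e p)
    (hβ : IsGeodesicFromTo β p x)
    (hmin : ∀ s ∈ Icc (0:ℝ) (dist p x), dist e p ≤ dist e (β s))
    (hγ : IsMorseGeodesicFromTo N γ e x) :
    ∀ t ∈ Icc (0:ℝ) (dist e p), dist (α t) (γ t) ≤ 2 * N 3 0 := by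
  intro t ht
  obtain ⟨⟨⟨hg0, hg⟩, hγ0, hγ1⟩, hM⟩ := hγ
  have hq := concat_quasi e p x α β hα hβ hmin
  obtain ⟨⟨ha0, ha⟩, hα0, hα1⟩ := hα
  obtain ⟨⟨hb0, hb⟩, hβ0, hβ1⟩ := hβ
  have hx := hmin (dist p x) ⟨hb0, le_rfl⟩
  rw [hβ1] at hx
  obtain ⟨g, ⟨u, hu, rfl⟩, hgd⟩ := hM 3 0 (by norm_num) le_rfl 0 (dist e p + dist p x) (by linarith)
    _ hq (by
      simp only [if_pos ha0, hα0]
      exact ⟨0, ⟨le_rfl, hg0⟩, hγ0⟩) (by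
      refine ⟨dist e x, ⟨hg0, le_rfl⟩, ?_⟩
      rw [hγ1]
      split_ifs with h
      · have h0 : dist p x = 0 := by linarith
        rw [h0, add_zero, hα1]
        exact (dist_eq_zero.1 h0).symm
      · rw [add_sub_cancel_left, hβ1]) t ⟨ht.1, by linarith [ht.2]⟩
  simp only [if_pos ht.2] at hgd
  have h1 : dist e (α t) = t := by
    conv_lhs => rw [← hα0]
    rw [ha 0 ⟨le_rfl, ha0⟩ t ht, zero_sub, abs_neg, abs_of_nonneg ht.1]
  have h2 : dist e (γ u) = u := by
    conv_lhs => rw [← hγ0]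
    rw [hg 0 ⟨le_rfl, hg0⟩ u hu, zero_sub, abs_neg, abs_of_nonneg hu.1]
  have h3 : |u - t| ≤ N 3 0 := by
    have k1 := dist_triangle e (α t) (γ u)
    have k2 := dist_triangle e (γ u) (α t)
    rw [dist_comm (γ u)] at k2
    rw [abs_le]; constructor <;> linarith
  have h4 := hg u hu t ⟨ht.1, ht.2.trans hx⟩
  have h5 := dist_triangle (α t) (γ u) (γ t)
  linarith

lemma fellow (hX : GeodesicSpace X) (N : ℝ → ℝ → ℝ) (e x y : X) (γ γ' : ℝ → X)
    (hγ : IsMorseGeodesicFromTo N γ e x) (hγ' : IsMorseGeodesicFromTo N γ' e y) :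
    ∀ t ∈ Icc (0:ℝ) (gprod e x y), dist (γ t) (γ' t) ≤ 4 * N 3 0 := by
  intro t ht
  obtain ⟨β, ⟨hb0, hb⟩, hβ0, hβ1⟩ := hX x y
  have hcont : ContinuousOn (fun s => dist e (β s)) (Icc 0 (dist x y)) := by
    have : ContinuousOn β (Icc 0 (dist x y)) := by
      have hl : LipschitzOnWith 1 β (Icc 0 (dist x y)) := by
        apply LipschitzOnWith.of_dist_le_mul
        intro s hs t ht
        rw [hb s hs t ht, Real.dist_eq]; simp
      exact hl.continuousOn
    exact (show Continuous (fun q : X => dist e q) from by fun_prop).comp_continuousOn this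
  obtain ⟨c, hc, hcmin⟩ := isCompact_Icc.exists_isMinOn ⟨0, le_rfl, hb0⟩ hcont
  have hcm : ∀ s ∈ Icc 0 (dist x y), dist e (β c) ≤ dist e (β s) := fun s hs => hcmin hs
  obtain ⟨α, hα⟩ := hX e (β c)
  have dx : dist (β c) x = c := by
    conv_lhs => rw [← hβ0]
    rw [hb c hc 0 ⟨le_rfl, hb0⟩, sub_zero, abs_of_nonneg hc.1]
  have dy : dist (β c) y = dist x y - c := by
    conv_lhs => rw [← hβ1]
    rw [hb c hc _ ⟨hb0, le_rfl⟩, abs_sub_comm, abs_of_nonneg (by linarith [hc.2])]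
  have hbound : gprod e x y ≤ dist e (β c) := by
    unfold gprod
    have k1 := dist_triangle e (β c) x
    have k2 := dist_triangle e (β c) y
    linarith
  have ht' : t ∈ Icc (0:ℝ) (dist e (β c)) := ⟨ht.1, ht.2.trans hbound⟩
  have A := side_close N e (β c) x α (fun s => β (c - s)) γ hα (by
    refine ⟨⟨dist_nonneg, ?_⟩, ?_, ?_⟩
    · rw [dx]; intro s hs t ht
      rw [hb (c - s) ⟨by linarith [hs.2], by linarith [hs.1, hc.2]⟩ (c - t)
        ⟨by linarith [ht.2], by linarith [ht.1, hc.2]⟩]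
      rw [abs_sub_comm]; congr 1; ring
    · simp
    · simp only [dx, sub_self, hβ0]) (by
    rw [dx]; intro s hs
    exact hcm _ ⟨by linarith [hs.2], by linarith [hs.1, hc.2]⟩) hγ t ht'
  have B := side_close N e (β c) y α (fun s => β (c + s)) γ' hα (by
    refine ⟨⟨dist_nonneg, ?_⟩, ?_, ?_⟩
    · rw [dy]; intro s hs t ht
      rw [hb (c + s) ⟨by linarith [hs.1, hc.1], by linarith [hs.2]⟩ (c + t)
        ⟨by linarith [ht.1, hc.1], by linarith [ht.2]⟩]
      congr 1; ring
    · simp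
    · simp only [dy, add_sub_cancel, hβ1]) (by
    rw [dy]; intro s hs
    exact hcm _ ⟨by linarith [hs.1, hc.1], by linarith [hs.2]⟩) hγ' t ht'
  have C := dist_triangle_left (γ t) (γ' t) (α t)
  linarith

lemma four_point (hX : GeodesicSpace X) (N : ℝ → ℝ → ℝ) (e x y z : X)
    (hx : x ∈ morseStratum N e) (hy : y ∈ morseStratum N e) (hz : z ∈ morseStratum N e) :
    min (gprod e x y) (gprod e y z) - 4 * N 3 0 ≤ gprod e x z := by
  obtain ⟨γ, hγ⟩ := hx
  obtain ⟨γ', hγ'⟩ := hy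
  obtain ⟨γ'', hγ''⟩ := hz
  set t := min (gprod e x y) (gprod e y z) with ht
  have h0 : 0 ≤ t := le_min (gprod_nonneg' _ _ _) (gprod_nonneg' _ _ _)
  have A := fellow hX N e x y γ γ' hγ hγ' t ⟨h0, min_le_left _ _⟩
  have B := fellow hX N e y z γ' γ'' hγ' hγ'' t ⟨h0, min_le_right _ _⟩
  have tx : t ≤ dist e x := (min_le_left _ _).trans (gprod_le_left _ _ _)
  have tz : t ≤ dist e z := (min_le_right _ _).trans (gprod_le_right _ _ _)
  obtain ⟨⟨⟨_, hg⟩, _, h1⟩, _⟩ := hγ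
  obtain ⟨⟨⟨_, hg'⟩, _, h1'⟩, _⟩ := hγ''
  have C : dist x (γ t) = dist e x - t := by
    conv_lhs => rw [← h1]
    rw [hg _ ⟨dist_nonneg, le_rfl⟩ t ⟨h0, tx⟩, abs_of_nonneg (by linarith)]
  have D : dist (γ'' t) z = dist e z - t := by
    conv_lhs => rw [← h1']
    rw [hg' t ⟨h0, tz⟩ _ ⟨dist_nonneg, le_rfl⟩, abs_sub_comm, abs_of_nonneg (by linarith)]
  have E1 := dist_triangle4 x (γ t) (γ'' t) z
  have E2 := dist_triangle (γ t) (γ' t) (γ'' t)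
  have : gprod e x z = (dist e x + dist e z - dist x z) / 2 := rfl
  linarith

lemma equivAtInf_iff (e : X) (f g : ℕ → X) :
    EquivAtInf e f g ↔ ∀ M : ℝ, ∃ n : ℕ, ∀ i ≥ n, ∀ j ≥ n, M ≤ gprod e (f i) (g j) := by
  unfold EquivAtInf
  rw [tendsto_atTop]
  refine forall_congr' fun M => ?_
  rw [eventually_atTop]
  constructor
  · rintro ⟨⟨a, b⟩, h⟩
    exact ⟨max a b, fun i hi j hj => h (i, j) ⟨(le_max_left _ _).trans hi, (le_max_right _ _).trans hj⟩⟩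
  · rintro ⟨n, h⟩
    exact ⟨(n, n), fun p hp => h p.1 hp.1 p.2 hp.2⟩

def FourPt (S : Set X) (e : X) (δ : ℝ) : Prop :=
  ∀ x ∈ S, ∀ y ∈ S, ∀ z ∈ S, min (gprod e x y) (gprod e y z) - δ ≤ gprod e x z

lemma equiv_symm (e : X) (f g : ℕ → X) (h : EquivAtInf e f g) : EquivAtInf e g f := by
  rw [equivAtInf_iff] at *
  intro M
  obtain ⟨n, hn⟩ := h M
  exact ⟨n, fun i hi j hj => by rw [gprod_comm']; exact hn j hj i hi⟩

lemma mk_eq_iff {S : Set X} {e : X} {δ : ℝ} (hS : FourPt S e δ) (f g : BSeq S e) :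
    SeqBoundary.mk f = SeqBoundary.mk g ↔ EquivAtInf e f.1 g.1 := by
  constructor
  · intro h
    have h' := Quot.eqvGen_exact h
    induction h' with
    | rel _ _ h1 => exact h1
    | refl x => exact x.2.2
    | symm _ _ h1 ih => exact equiv_symm _ _ _ (ih (Quot.eqvGen_sound h1))
    | trans x y z h1 h2 ih1 ih2 =>
      have A := ih1 (Quot.eqvGen_sound h1)
      have B := ih2 (Quot.eqvGen_sound h2)
      rw [equivAtInf_iff] at *
      intro M
      obtain ⟨n, hn⟩ := A (M + δ)
      obtain ⟨m, hm⟩ := B (M + δ)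
      refine ⟨max n m, fun i hi j hj => ?_⟩
      have hi' : n ≤ i := (le_max_left _ _).trans hi
      have hj' : m ≤ j := (le_max_right _ _).trans hj
      have k1 := hn i hi' (max n m) (le_max_left _ _)
      have k2 := hm (max n m) (le_max_right _ _) j hj'
      have k3 := hS _ (x.2.1 i) _ (y.2.1 (max n m)) _ (z.2.1 j)
      have := le_min k1 k2
      linarith
  · intro h; exact Quot.sound h

/-- Boundary map induced by an inclusion. -/
def bdMap {S T : Set X} {e : X} (h : S ⊆ T) (ξ : SeqBoundary S e) : SeqBoundary T e :=
  Quot.map (fun f : BSeq S e => (⟨f.1, fun n => h (f.2.1 n), f.2.2⟩ : BSeq T e))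
    (fun _ _ hh => hh) ξ

lemma bGP_le {S T : Set X} {e : X} (h : S ⊆ T) (ξ η : SeqBoundary S e) :
    bGP S e ξ η ≤ bGP T e (bdMap h ξ) (bdMap h η) := by
  apply sSup_le_sSup
  rintro r ⟨f, g, rfl, rfl, rfl⟩
  exact ⟨⟨f.1, fun n => h (f.2.1 n), f.2.2⟩, ⟨g.1, fun n => h (g.2.1 n), g.2.2⟩, rfl, rfl, rfl⟩

lemma bGP_nonneg {S : Set X} {e : X} (ξ η : SeqBoundary S e) : 0 ≤ bGP S e ξ η := by
  obtain ⟨f, rfl⟩ := Quot.exists_rep ξ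
  obtain ⟨g, rfl⟩ := Quot.exists_rep η
  refine le_trans ?_ (le_sSup ⟨f, g, rfl, rfl, rfl⟩)
  refine le_liminf_of_le (by isBoundedDefault) (Eventually.of_forall fun p => ?_)
  exact_mod_cast gprod_nonneg' _ _ _

lemma bGP_ge {S T : Set X} {e : X} (h : S ⊆ T) {δ : ℝ} (hδ : 0 ≤ δ) (hT : FourPt T e δ)
    (ξ η : SeqBoundary S e) (r : ℝ) (hr : (r : EReal) < bGP T e (bdMap h ξ) (bdMap h η)) :
    ((r - 2 * δ : ℝ) : EReal) ≤ bGP S e ξ η := by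
  obtain ⟨f, rfl⟩ := Quot.exists_rep ξ
  obtain ⟨g, rfl⟩ := Quot.exists_rep η
  refine le_trans ?_ (le_sSup ⟨f, g, rfl, rfl, rfl⟩)
  obtain ⟨_, ⟨f', g', hf, hg, rfl⟩, hr'⟩ := lt_sSup_iff.1 hr
  have ev := eventually_lt_of_lt_liminf hr' (by isBoundedDefault)
  rw [eventually_atTop] at ev
  obtain ⟨⟨a, b⟩, hab⟩ := ev
  have hf' := (mk_eq_iff hT f' ⟨f.1, fun n => h (f.2.1 n), f.2.2⟩).1 hf
  have hg' := (mk_eq_iff hT g' ⟨g.1, fun n => h (g.2.1 n), g.2.2⟩).1 hg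
  rw [equivAtInf_iff] at hf' hg'
  obtain ⟨n, hn⟩ := hf' r
  obtain ⟨m, hm⟩ := hg' r
  refine le_liminf_of_le (by isBoundedDefault) ?_
  rw [eventually_atTop]
  refine ⟨(max a n, max b m), ?_⟩
  rintro ⟨i, j⟩ ⟨hi, hj⟩
  simp only at hi hj ⊢
  have hai := (le_max_left _ _).trans hi
  have hni := (le_max_right _ _).trans hi
  have hbj := (le_max_left _ _).trans hj
  have hmj := (le_max_right _ _).trans hj
  have k1 := hab (i, j) ⟨hai, hbj⟩
  have k1' : r < gprod e (f'.1 i) (g'.1 j) := by exact_mod_cast k1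
  have k2 := hn i hni i hni
  have k3 := hm j hmj j hmj
  rw [gprod_comm'] at k2
  have q1 := hT _ (h (f.2.1 i)) _ (f'.2.1 i) _ (g'.2.1 j)
  have q2 := hT _ (h (f.2.1 i)) _ (g'.2.1 j) _ (h (g.2.1 j))
  have r1 := le_min k2 k1'.le
  have r2 : r - δ ≤ gprod e (f.1 i) (g'.1 j) := by simp only at r1; linarith
  have r3 := le_min r2 (show r - δ ≤ gprod e (g'.1 j) (g.1 j) by simp only at k3; linarith)
  have : r - 2 * δ ≤ gprod e (f.1 i) (g.1 j) := by linarith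
  exact_mod_cast this

lemma bGP_real {S T : Set X} {e : X} (h : S ⊆ T) {δ : ℝ} (hδ : 0 ≤ δ) (hT : FourPt T e δ)
    (ξ η : SeqBoundary S e) (h1 : bGP S e ξ η ≠ ⊤)
    (h2 : bGP T e (bdMap h ξ) (bdMap h η) ≠ ⊤) :
    (bGP S e ξ η).toReal ≤ (bGP T e (bdMap h ξ) (bdMap h η)).toReal ∧
    (bGP T e (bdMap h ξ) (bdMap h η)).toReal ≤ (bGP S e ξ η).toReal + 2 * δ := by
  have b1 : bGP S e ξ η ≠ ⊥ := fun hh => by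
    have := bGP_nonneg ξ η; rw [hh] at this; simp at this
  have b2 : bGP T e (bdMap h ξ) (bdMap h η) ≠ ⊥ := fun hh => by
    have := bGP_nonneg (bdMap h ξ) (bdMap h η); rw [hh] at this; simp at this
  have A := bGP_le h ξ η
  have B := bGP_ge h hδ hT ξ η
  lift bGP S e ξ η to ℝ using ⟨h1, b1⟩ with u
  lift bGP T e (bdMap h ξ) (bdMap h η) to ℝ using ⟨h2, b2⟩ with v
  simp only [EReal.toReal_coe]
  refine ⟨by exact_mod_cast A, ?_⟩
  apply le_of_forall_lt
  intro c hc
  by_contra hcon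
  push Not at hcon
  have := B ((c + v)/2) (by exact_mod_cast (by linarith))
  have : (c + v)/2 - 2 * δ ≤ u := by exact_mod_cast this
  linarith

lemma visual_bound {S : Set X} {e : X} {d : SeqBoundary S e → SeqBoundary S e → ℝ}
    (hd : IsVisualMetric S e d) : ∃ ε > 0, ∃ k₁ > 0, ∃ k₂ > 0, ∀ ξ η, ξ ≠ η →
      bGP S e ξ η ≠ ⊤ ∧ 0 < d ξ η ∧ k₁ * Real.exp (-ε * (bGP S e ξ η).toReal) ≤ d ξ η ∧
      d ξ η ≤ k₂ * Real.exp (-ε * (bGP S e ξ η).toReal) := by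
  obtain ⟨h0, -, -, hz, ε, hε, k₁, hk₁, k₂, hk₂, H⟩ := hd
  refine ⟨ε, hε, k₁, hk₁, k₂, hk₂, fun ξ η hne => ?_⟩
  have hp : 0 < d ξ η := lt_of_le_of_ne (h0 _ _) (fun hh => hne ((hz _ _).1 hh.symm))
  obtain ⟨H1, H2⟩ := H ξ η
  have ht : bGP S e ξ η ≠ ⊤ := by
    intro ht
    rw [ht] at H2
    simp [visGauge] at H2
    linarith
  simp only [visGauge, if_neg ht] at H1 H2
  exact ⟨ht, hp, H1, H2⟩

lemma homeo_pow (C p : ℝ) (hC : 0 < C) (hp : 0 < p) : IsHomeoIci (fun t => C * t ^ p) := by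
  refine ⟨?_, ?_, ?_, ?_, ?_⟩
  · exact (continuous_const.mul (Real.continuous_rpow_const hp.le)).continuousOn
  · intro s hs t ht hst
    exact mul_lt_mul_of_pos_left (Real.rpow_lt_rpow hs hst hp) hC
  · simp [Real.zero_rpow hp.ne']
  · exact (tendsto_rpow_atTop hp).const_mul_atTop hC
  · intro t ht
    exact mul_nonneg hC.le (Real.rpow_nonneg ht _)

lemma bdMap_inj {S T : Set X} {e : X} (h : S ⊆ T) {δ : ℝ} (hT : FourPt T e δ) :
    Function.Injective (bdMap (e := e) h) := by
  intro ξ η hh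
  obtain ⟨f, rfl⟩ := Quot.exists_rep ξ
  obtain ⟨g, rfl⟩ := Quot.exists_rep η
  exact Quot.sound ((mk_eq_iff hT ⟨f.1, fun n => h (f.2.1 n), f.2.2⟩
    ⟨g.1, fun n => h (g.2.1 n), g.2.2⟩).1 hh)

lemma quasi_symm {S T : Set X} {e : X} (h : S ⊆ T) {δ : ℝ} (hδ : 0 ≤ δ) (hT : FourPt T e δ)
    (d d') (hd : IsVisualMetric S e d) (hd' : IsVisualMetric T e d') :
    IsQuasiSymmetryOnto d d' (bdMap h) := by
  have hinj := bdMap_inj (e := e) h hT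
  refine ⟨hinj, ?_⟩
  obtain ⟨ε, hε, k₁, hk₁, k₂, hk₂, H⟩ := visual_bound hd
  obtain ⟨ε', hε', l₁, hl₁, l₂, hl₂, H'⟩ := visual_bound hd'
  refine ⟨fun t => (l₂ / l₁ * Real.exp (ε' * (2 * δ)) * (k₂ / k₁) ^ (ε' / ε)) * t ^ (ε' / ε),
    homeo_pow _ _ (by positivity) (by positivity), ?_⟩
  intro x y z hxy hxz _
  obtain ⟨t1, p1, a1, b1⟩ := H x y hxy
  obtain ⟨t2, p2, a2, b2⟩ := H x z hxz
  obtain ⟨t1', p1', a1', b1'⟩ := H' _ _ (hinj.ne hxy)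
  obtain ⟨t2', p2', a2', b2'⟩ := H' _ _ (hinj.ne hxz)
  obtain ⟨c1, -⟩ := bGP_real h hδ hT x y t1 t1'
  obtain ⟨-, c2⟩ := bGP_real h hδ hT x z t2 t2'
  set u := (bGP S e x y).toReal
  set v := (bGP S e x z).toReal
  set u' := (bGP T e (bdMap h x) (bdMap h y)).toReal
  set v' := (bGP T e (bdMap h x) (bdMap h z)).toReal
  have s1 : Real.exp (-ε * (u - v)) ≤ (k₂ / k₁) * (d x y / d x z) := by
    have : -ε * (u - v) = -ε * u - -ε * v := by ring
    rw [this, Real.exp_sub, div_mul_div_comm, div_le_div_iff₀ (Real.exp_pos _) (by positivity)]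
    calc Real.exp (-ε * u) * (k₁ * d x z) = (k₁ * Real.exp (-ε * u)) * d x z := by ring
      _ ≤ d x y * (k₂ * Real.exp (-ε * v)) := mul_le_mul a1 b2 p2.le p1.le
      _ = _ := by ring
  have s2 : d' (bdMap h x) (bdMap h y) / d' (bdMap h x) (bdMap h z)
      ≤ l₂ / l₁ * Real.exp (-ε' * (u' - v')) := by
    have : -ε' * (u' - v') = -ε' * u' - -ε' * v' := by ring
    rw [this, Real.exp_sub, div_mul_div_comm]
    exact div_le_div₀ (by positivity) b1' (by positivity) a2'
  have s3 : Real.exp (-ε' * (u' - v')) ≤ Real.exp (ε' * (2 * δ)) * Real.exp (-ε' * (u - v)) := by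
    rw [← Real.exp_add]
    apply Real.exp_le_exp.2
    nlinarith
  have s4 : Real.exp (-ε' * (u - v)) = Real.exp (-ε * (u - v)) ^ (ε' / ε) := by
    rw [← Real.exp_mul]; congr 1; field_simp
  have s5 : Real.exp (-ε * (u - v)) ^ (ε' / ε) ≤ (k₂ / k₁) ^ (ε' / ε) * (d x y / d x z) ^ (ε' / ε) := by
    rw [← Real.mul_rpow (by positivity) (by positivity)]
    exact Real.rpow_le_rpow (Real.exp_pos _).le s1 (by positivity)
  calc _ ≤ _ := s2
    _ ≤ l₂ / l₁ * (Real.exp (ε' * (2 * δ)) *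
        ((k₂ / k₁) ^ (ε' / ε) * (d x y / d x z) ^ (ε' / ε))) := by
      apply mul_le_mul_of_nonneg_left _ (by positivity)
      refine s3.trans (mul_le_mul_of_nonneg_left ?_ (Real.exp_pos _).le)
      rw [s4]; exact s5
    _ = _ := by ring

end Helpers

/-- for `N ≤ N'` the inclusion `X^(N)_e ⊆ X^(N')_e` induces a
well-defined injective boundary map which is a quasi-symmetry onto its image for
any visual metrics. -/
theorem statement5 {X : Type*} [MetricSpace X] (hX : GeodesicSpace X) (e : X)
    (N N' : ℝ → ℝ → ℝ) (hN : IsMorseGauge N) (hN' : IsMorseGauge N')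
    (hle : ∀ K C : ℝ, N K C ≤ N' K C) :
    morseStratum N e ⊆ morseStratum N' e ∧
    ∃ ι : SeqBoundary (morseStratum N e) e → SeqBoundary (morseStratum N' e) e,
      (∀ (f : BSeq (morseStratum N e) e) (g : BSeq (morseStratum N' e) e),
          (∀ n, g.1 n = f.1 n) → ι (SeqBoundary.mk f) = SeqBoundary.mk g) ∧
      Function.Injective ι ∧
      ∀ d d', IsVisualMetric (morseStratum N e) e d →
        IsVisualMetric (morseStratum N' e) e d' →
        IsQuasiSymmetryOnto d d' ι := by
  have hsub : morseStratum N e ⊆ morseStratum N' e := by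
    rintro y ⟨γ, hγ, hM⟩
    refine ⟨γ, hγ, fun K C hK hC a b hab σ hσ ha hb s hs => ?_⟩
    obtain ⟨g, hg, hd⟩ := hM K C hK hC a b hab σ hσ ha hb s hs
    exact ⟨g, hg, hd.trans (hle K C)⟩
  have hT : FourPt (morseStratum N' e) e (4 * N' 3 0) :=
    fun x hx y hy z hz => four_point hX N' e x y z hx hy hz
  have hδ : 0 ≤ 4 * N' 3 0 := by
    have := hN' 3 0 (by norm_num) le_rfl
    linarith
  refine ⟨hsub, bdMap hsub, ?_, bdMap_inj hsub hT, fun d d' hd hd' => quasi_symm hsub hδ hT d d' hd hd'⟩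
  rintro ⟨f, hf⟩ ⟨g, hg⟩ hfg
  obtain rfl : g = f := funext hfg
  rfl
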